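/- (Green's formula for the bosonic Laplacian on the unit ball, scalar-valued version) Let m ≥ 3 and k ≥ 1 be integers, and let f, g : ℝ^m × ℝ^m → ℝ take values in H_k with C² coefficients. Let B₁ = {x ∈ ℝ^m : |x| < 1}, let σ be the surface measure on the unit sphere {x : |x| = 1} (whose outward unit normal at x is n_x = x), and define the boundary operator (A φ)(x,u) = Σ_{j=1}^m x_j ∂_{x_j}φ(x,u) − (4/(m+2k−2)) ⟨u,x⟩ Σ_{j=1}^m ∂_{u_j}∂_{x_j}φ(x,u). Then ∫_{B₁} ∫_{S^{m−1}} [ (D_k f)(x,u) g(x,u) − f(x,u) (D_k g)(x,u) ] dS(u) dx = ∫_{{|x|=1}} ∫_{S^{m−1}} [ (A f)(x,u) g(x,u) − f(x,u) (A g)(x,u) ] dS(u) dσ(x). -/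

import Mathlib

open MeasureTheory
open scoped RealInnerProductSpace

noncomputable section

/-- Partial derivative `∂_{x_i} g(x)` of a function of one Euclidean variable. -/
def pd {m : ℕ} {V : Type*} [NormedAddCommGroup V] [NormedSpace ℝ V]
    (g : EuclideanSpace ℝ (Fin m) → V) (i : Fin m) :
    EuclideanSpace ℝ (Fin m) → V :=
  fun x => fderiv ℝ g x (EuclideanSpace.single i 1)

/-- Partial derivative `∂_{x_i} f(x,u)` in the first variable of a function of two
Euclidean variables. -/
def pdx {m : ℕ} {V : Type*} [NormedAddCommGroup V] [NormedSpace ℝ V]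
    (f : EuclideanSpace ℝ (Fin m) → EuclideanSpace ℝ (Fin m) → V) (i : Fin m) :
    EuclideanSpace ℝ (Fin m) → EuclideanSpace ℝ (Fin m) → V :=
  fun x u => fderiv ℝ (fun x' => f x' u) x (EuclideanSpace.single i 1)

/-- Partial derivative `∂_{u_i} f(x,u)` in the second variable of a function of two
Euclidean variables. -/
def pdu {m : ℕ} {V : Type*} [NormedAddCommGroup V] [NormedSpace ℝ V]
    (f : EuclideanSpace ℝ (Fin m) → EuclideanSpace ℝ (Fin m) → V) (i : Fin m) :
    EuclideanSpace ℝ (Fin m) → EuclideanSpace ℝ (Fin m) → V :=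
  fun x u => fderiv ℝ (fun u' => f x u') u (EuclideanSpace.single i 1)

/-- `f(x,u)` takes values in `H_k`: `f(x,u) = Σ_{|α|=k} c_α(x) u^α` with all coefficients
`c_α` satisfying the regularity predicate `P`, and `u ↦ f(x,u)` harmonic for every `x`. -/
def ValuesInHk (m k : ℕ) (P : (EuclideanSpace ℝ (Fin m) → ℝ) → Prop)
    (f : EuclideanSpace ℝ (Fin m) → EuclideanSpace ℝ (Fin m) → ℝ) : Prop :=
  (∃ (s : Finset (Fin m → ℕ)) (c : (Fin m → ℕ) → EuclideanSpace ℝ (Fin m) → ℝ),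
      (∀ α ∈ s, ∑ i, α i = k) ∧ (∀ α ∈ s, P (c α)) ∧
      (∀ x u, f x u = ∑ α ∈ s, c α x * ∏ i, (u i) ^ (α i))) ∧
  (∀ x u, ∑ j, pdu (pdu f j) j x u = 0)

/-- The bosonic Laplacian (higher spin Laplace operator) `D_k`. -/
def bosonicLaplacian (m k : ℕ)
    (f : EuclideanSpace ℝ (Fin m) → EuclideanSpace ℝ (Fin m) → ℝ) :
    EuclideanSpace ℝ (Fin m) → EuclideanSpace ℝ (Fin m) → ℝ :=
  fun x u =>
    (∑ i, pdx (pdx f i) i x u)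
      - (4 / ((m : ℝ) + 2 * k - 2)) * ∑ i, ∑ j, u i * pdu (pdx (pdx f j) i) j x u
      + (4 * ‖u‖ ^ 2 / (((m : ℝ) + 2 * k - 2) * ((m : ℝ) + 2 * k - 4))) *
          ∑ i, ∑ j, pdu (pdu (pdx (pdx f j) i) j) i x u

/-- The surface measure `dS` on the unit sphere `S^{m-1} ⊆ ℝ^m`. -/
def sphereMeasure (m : ℕ) : Measure (Metric.sphere (0 : EuclideanSpace ℝ (Fin m)) 1) :=
  (volume : Measure (EuclideanSpace ℝ (Fin m))).toSphere

/-- The boundary operator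
`(A φ)(x,u) = ∂φ/∂n_x - (4/(m+2k-2)) ⟨u,n_x⟩ ⟨D_u,D_x⟩ φ` on the unit sphere,
where `n_x = x` is the outward unit normal. -/
def boundaryOp (m k : ℕ)
    (φ : EuclideanSpace ℝ (Fin m) → EuclideanSpace ℝ (Fin m) → ℝ) :
    EuclideanSpace ℝ (Fin m) → EuclideanSpace ℝ (Fin m) → ℝ :=
  fun x u =>
    (∑ j, x j * pdx φ j x u)
      - (4 / ((m : ℝ) + 2 * k - 2)) * ⟪u, x⟫ * ∑ j, pdu (pdx φ j) j x u

local notation "𝔼" m:max => EuclideanSpace ℝ (Fin m)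
local notation "𝕊" m:max => Metric.sphere (0 : EuclideanSpace ℝ (Fin m)) 1
local notation "𝔹" m:max => Metric.ball (0 : EuclideanSpace ℝ (Fin m)) 1

instance isFiniteMeasure_sphereMeasure (m : ℕ) : IsFiniteMeasure (sphereMeasure m) := by
  unfold sphereMeasure; infer_instance

theorem fderiv_apply_eq_sum_pd {m : ℕ} (g : (𝔼 m) → ℝ) (x v : 𝔼 m) :
    fderiv ℝ g x v = ∑ j, v j * pd g j x := by
  conv_lhs => rw [← (EuclideanSpace.basisFun (Fin m) ℝ).sum_repr v]
  simp [pd]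

theorem continuous_pd {m : ℕ} {g : (𝔼 m) → ℝ} (hg : ContDiff ℝ 1 g) (i : Fin m) :
    Continuous (pd g i) :=
  (hg.continuous_fderiv one_ne_zero).clm_apply continuous_const

theorem contDiff_pd {m : ℕ} {n : WithTop ℕ∞} {g : (𝔼 m) → ℝ} (hg : ContDiff ℝ (n + 1) g)
    (i : Fin m) : ContDiff ℝ n (pd g i) :=
  (hg.fderiv_right le_rfl).clm_apply contDiff_const

theorem pd_mul {m : ℕ} {p q : (𝔼 m) → ℝ} {x : 𝔼 m} (hp : DifferentiableAt ℝ p x)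
    (hq : DifferentiableAt ℝ q x) (i : Fin m) :
    pd (fun y => p y * q y) i x = p x * pd q i x + pd p i x * q x := by
  unfold pd
  rw [fderiv_fun_mul hp hq]
  simp [mul_comm]

theorem pd_sub {m : ℕ} {p q : (𝔼 m) → ℝ} {x : 𝔼 m} (hp : DifferentiableAt ℝ p x)
    (hq : DifferentiableAt ℝ q x) (i : Fin m) :
    pd (fun y => p y - q y) i x = pd p i x - pd q i x := by
  unfold pd
  rw [fderiv_fun_sub hp hq]
  simp

theorem pd_sum {m : ℕ} {ι : Type*} {s : Finset ι} {p : ι → (𝔼 m) → ℝ} {x : 𝔼 m}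
    (hp : ∀ a ∈ s, DifferentiableAt ℝ (p a) x) (i : Fin m) :
    pd (fun y => ∑ a ∈ s, p a y) i x = ∑ a ∈ s, pd (p a) i x := by
  unfold pd
  rw [fderiv_fun_sum hp]
  simp

theorem contDiff_coord {m : ℕ} {n : WithTop ℕ∞} (j : Fin m) :
    ContDiff ℝ n (fun x : 𝔼 m => x j) :=
  (EuclideanSpace.proj j : (𝔼 m) →L[ℝ] ℝ).contDiff

theorem differentiable_coord {m : ℕ} (j : Fin m) : Differentiable ℝ (fun x : 𝔼 m => x j) :=
  (EuclideanSpace.proj j : (𝔼 m) →L[ℝ] ℝ).differentiable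

theorem pd_coord {m : ℕ} (i j : Fin m) (x : 𝔼 m) :
    pd (fun y : 𝔼 m => y j) i x = if j = i then 1 else 0 := by
  have h : HasFDerivAt (fun y : 𝔼 m => y j) (EuclideanSpace.proj j : (𝔼 m) →L[ℝ] ℝ) x :=
    (EuclideanSpace.proj j : (𝔼 m) →L[ℝ] ℝ).hasFDerivAt
  simp [pd, h.fderiv]

theorem pd_const_mul {m : ℕ} {p : (𝔼 m) → ℝ} {x : 𝔼 m} (hp : DifferentiableAt ℝ p x)
    (a : ℝ) (i : Fin m) : pd (fun y => a * p y) i x = a * pd p i x := by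
  unfold pd
  rw [fderiv_const_mul hp]
  simp

theorem pd_mul_const {m : ℕ} {p : (𝔼 m) → ℝ} {x : 𝔼 m} (hp : DifferentiableAt ℝ p x)
    (a : ℝ) (i : Fin m) : pd (fun y => p y * a) i x = pd p i x * a := by
  simp_rw [mul_comm _ a, pd_const_mul hp]

theorem Continuous.integrableOn_unitBall {m : ℕ} {w : (𝔼 m) → ℝ} (hw : Continuous w) :
    IntegrableOn w (𝔹 m) :=
  (hw.continuousOn.integrableOn_compact (isCompact_closedBall 0 1)).mono_set
    Metric.ball_subset_closedBall

theorem Continuous.integrable_sphere {m : ℕ} {w : (𝔼 m) → ℝ} (hw : Continuous w) :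
    Integrable (fun u : 𝕊 m => w u) (sphereMeasure m) :=
  (hw.comp continuous_subtype_val).integrable_of_hasCompactSupport
    (HasCompactSupport.of_compactSpace _)

theorem integral_unitBall_eq_polar {m : ℕ} (hm : 0 < m) {w : (𝔼 m) → ℝ} (hw : Continuous w) :
    ∫ x in 𝔹 m, w x
      = ∫ θ : 𝕊 m, (∫ r in (0 : ℝ)..1, r ^ (m - 1) * w (r • (θ : 𝔼 m))) ∂(sphereMeasure m) := by
  have : Nonempty (Fin m) := ⟨⟨0, hm⟩⟩
  set v : (𝔼 m) → ℝ := (𝔹 m).indicator w with hv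
  have hvi : Integrable v := (integrable_indicator_iff measurableSet_ball).2
    hw.integrableOn_unitBall
  have hmp := (volume : Measure (𝔼 m)).measurePreserving_homeomorphUnitSphereProd
  have hemb := (homeomorphUnitSphereProd (𝔼 m)).measurableEmbedding
  set G : (𝕊 m) × Set.Ioi (0 : ℝ) → ℝ := fun z => v ((z.2 : ℝ) • (z.1 : 𝔼 m)) with hG
  have hGv : ∀ y : ({0}ᶜ : Set (𝔼 m)), G (homeomorphUnitSphereProd (𝔼 m) y) = v y := by
    intro y
    have : ‖(y : 𝔼 m)‖ ≠ 0 := norm_ne_zero_iff.2 y.2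
    simp [hG, smul_smul, this]
  have hGi : Integrable G ((volume : Measure (𝔼 m)).toSphere.prod
      (Measure.volumeIoiPow (Module.finrank ℝ (𝔼 m) - 1))) := by
    rw [← hmp.integrable_comp_emb hemb]
    refine Integrable.congr (f := fun y : ({0}ᶜ : Set (𝔼 m)) => v y) ?_
      (Filter.Eventually.of_forall fun y => (hGv y).symm)
    exact (integrableOn_iff_comap_subtypeVal (measurableSet_singleton _).compl).1
      hvi.integrableOn
  calc ∫ x in 𝔹 m, w x = ∫ x, v x := (integral_indicator measurableSet_ball).symm
    _ = ∫ x : ({0}ᶜ : Set (𝔼 m)), v x ∂((volume : Measure (𝔼 m)).comap (↑)) := by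
      rw [integral_subtype_comap (measurableSet_singleton _).compl v, restrict_compl_singleton]
    _ = ∫ z, G z ∂((volume : Measure (𝔼 m)).toSphere.prod
          (Measure.volumeIoiPow (Module.finrank ℝ (𝔼 m) - 1))) := by
      rw [← hmp.integral_comp hemb G]
      simp_rw [hGv]
    _ = ∫ θ : 𝕊 m, (∫ r, G (θ, r) ∂(Measure.volumeIoiPow (Module.finrank ℝ (𝔼 m) - 1)))
          ∂(sphereMeasure m) := integral_prod _ hGi
    _ = _ := by
      congr 1
      ext θ
      have hθ : ‖(θ : 𝔼 m)‖ = 1 := by simp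
      simp only [Measure.volumeIoiPow, ENNReal.ofReal]
      rw [integral_withDensity_eq_integral_smul
        (measurable_subtype_coe.pow_const _).real_toNNReal,
        integral_subtype_comap measurableSet_Ioi fun a : ℝ =>
          Real.toNNReal (a ^ (Module.finrank ℝ (𝔼 m) - 1)) • v (a • (θ : 𝔼 m)),
        intervalIntegral.integral_of_le zero_le_one,
        integral_Ioc_eq_integral_Ioo, ← Set.Ioi_inter_Iio,
        ← integral_indicator (measurableSet_Ioi.inter measurableSet_Iio),
        ← integral_indicator measurableSet_Ioi]
      congr 1
      ext r
      by_cases h0 : 0 < r <;> by_cases h1 : r < 1 <;>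
        simp [hv, Set.indicator, h0, h1, hθ, norm_smul, abs_of_pos, NNReal.smul_def,
          Real.coe_toNNReal _ (pow_nonneg (le_of_lt _) _)]

theorem integral_unitBall_radial {m : ℕ} (hm : 0 < m) {p : (𝔼 m) → ℝ} (hp : ContDiff ℝ 1 p) :
    ∫ x in 𝔹 m, (m * p x + ∑ j, x j * pd p j x) = ∫ θ : 𝕊 m, p θ ∂(sphereMeasure m) := by
  have hc : Continuous fun x : 𝔼 m => m * p x + ∑ j, x j * pd p j x :=
    (continuous_const.mul hp.continuous).add <| continuous_finsetSum _ fun j _ =>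
      (contDiff_coord (n := 0) j).continuous.mul (continuous_pd hp j)
  rw [integral_unitBall_eq_polar hm hc]
  congr 1
  ext θ
  have hd : ∀ r : ℝ, HasDerivAt (fun r : ℝ => r ^ m * p (r • (θ : 𝔼 m)))
      (r ^ (m - 1) * (m * p (r • (θ : 𝔼 m))
        + ∑ j, (r • (θ : 𝔼 m)) j * pd p j (r • (θ : 𝔼 m)))) r := by
    intro r
    have h1 : HasDerivAt (fun r : ℝ => r • (θ : 𝔼 m)) (θ : 𝔼 m) r := by
      simpa using (hasDerivAt_id r).smul_const (θ : 𝔼 m)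
    have h2 := ((hp.differentiable one_ne_zero) (r • (θ : 𝔼 m))).hasFDerivAt.comp_hasDerivAt r h1
    refine ((hasDerivAt_pow m r).mul h2).congr_deriv ?_
    rw [← fderiv_apply_eq_sum_pd, map_smul]
    obtain ⟨n, rfl⟩ : ∃ n, m = n + 1 := ⟨m - 1, by omega⟩
    simp [pow_succ]
    ring
  rw [intervalIntegral.integral_eq_sub_of_hasDerivAt (fun r _ => hd r)]
  · simp [hm.ne']
  · apply Continuous.intervalIntegrable
    exact (continuous_pow _).mul (hc.comp (continuous_id.smul continuous_const))

theorem exists_bound_mul_deriv_smoothTransition :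
    ∃ C, ∀ s : ℝ, |s * deriv Real.smoothTransition s| ≤ C := by
  have hc : Continuous fun s : ℝ => s * deriv Real.smoothTransition s :=
    continuous_id.mul ((Real.smoothTransition.contDiff (n := 1)).continuous_deriv le_rfl)
  refine hc.bounded_above_of_compact_support
    (HasCompactSupport.intro (isCompact_Icc (a := (0 : ℝ)) (b := 1)) fun s hs => ?_)
  have : deriv Real.smoothTransition s = 0 := by
    rcases lt_or_ge s 0 with h | h
    · have : Real.smoothTransition =ᶠ[nhds s] fun _ => 0 := by
        filter_upwards [Iio_mem_nhds h] with t ht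
        exact Real.smoothTransition.zero_of_nonpos (le_of_lt ht)
      simp [this.deriv_eq]
    · have h1 : 1 < s := by
        by_contra h'
        exact hs ⟨h, not_lt.1 h'⟩
      have : Real.smoothTransition =ᶠ[nhds s] fun _ => 1 := by
        filter_upwards [Ioi_mem_nhds h1] with t ht
        exact Real.smoothTransition.one_of_one_le (le_of_lt ht)
      simp [this.deriv_eq]
  simp [this]

theorem integral_unitBall_div_eq_zero {m : ℕ} {W : Fin m → (𝔼 m) → ℝ}
    (hW : ∀ j, ContDiff ℝ 1 (W j)) {q : (𝔼 m) → ℝ} (hq : Continuous q)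
    (hWq : ∀ x, ∑ j, x j * W j x = (1 - ‖x‖ ^ 2) * q x) :
    ∫ x in 𝔹 m, ∑ j, pd (W j) j x = 0 := by
  set η := Real.smoothTransition with hη
  have hηc : ContDiff ℝ 1 η := Real.smoothTransition.contDiff
  set χ : ℕ → (𝔼 m) → ℝ := fun n x => η (n * (1 - ‖x‖ ^ 2)) with hχ
  set D : (𝔼 m) → ℝ := fun x => ∑ j, pd (W j) j x with hD
  have hDc : Continuous D := continuous_finsetSum _ fun j _ => continuous_pd (hW j) j
  have hχc : ∀ n, ContDiff ℝ 1 (χ n) := fun n =>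
    hηc.comp (contDiff_const.mul (contDiff_const.sub (contDiff_norm_sq ℝ)))
  have hout : ∀ n : ℕ, ∀ x : 𝔼 m, x ∉ 𝔹 m → (n : ℝ) * (1 - ‖x‖ ^ 2) ≤ 0 := by
    intro n x hx
    have : 1 ≤ ‖x‖ := by simpa using hx
    exact mul_nonpos_of_nonneg_of_nonpos n.cast_nonneg (by nlinarith)
  have hχ0 : ∀ n, ∀ x, x ∉ 𝔹 m → χ n x = 0 := fun n x hx =>
    Real.smoothTransition.zero_of_nonpos (hout n x hx)
  have hχs : ∀ n, HasCompactSupport (χ n) := fun n =>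
    HasCompactSupport.intro (isCompact_closedBall 0 1) fun x hx =>
      hχ0 n x fun h => hx (Metric.ball_subset_closedBall h)
  have hχd : ∀ n j x, pd (χ n) j x
      = -(2 * n * deriv η (n * (1 - ‖x‖ ^ 2))) * x j := by
    intro n j x
    have h1 : HasFDerivAt (fun y : 𝔼 m => (n : ℝ) * (1 - ‖y‖ ^ 2))
        ((n : ℝ) • ((0 : (𝔼 m) →L[ℝ] ℝ) - 2 • (innerSL ℝ x))) x :=
      ((hasFDerivAt_const (1 : ℝ) x).sub (hasStrictFDerivAt_norm_sq x).hasFDerivAt).const_mul _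
    have h2 := ((hηc.differentiable one_ne_zero) (n * (1 - ‖x‖ ^ 2))).hasDerivAt.comp_hasFDerivAt
      x h1
    have h3 : fderiv ℝ (χ n) x = _ := h2.fderiv
    simp only [pd, h3]
    simp [EuclideanSpace.inner_single_right]
    ring
  have key : ∀ n, ∫ x in 𝔹 m, χ n x * D x
      = ∫ x in 𝔹 m, 2 * ((n * (1 - ‖x‖ ^ 2)) * deriv η (n * (1 - ‖x‖ ^ 2))) * q x := by
    intro n
    rw [setIntegral_eq_integral_of_forall_compl_eq_zero fun x hx => by simp [hχ0 n x hx],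
      setIntegral_eq_integral_of_forall_compl_eq_zero]
    · have i1 : ∀ j, Integrable fun x => χ n x * pd (W j) j x := fun j =>
        ((hχc n).continuous.mul (continuous_pd (hW j) j)).integrable_of_hasCompactSupport
          ((hχs n).mul_right)
      have i2 : ∀ j, Integrable fun x => pd (χ n) j x * W j x := fun j =>
        ((continuous_pd (hχc n) j).mul (hW j).continuous).integrable_of_hasCompactSupport
          (((hχs n).fderiv_apply ℝ _).mul_right)
      have i3 : ∀ j, Integrable fun x => χ n x * W j x := fun j =>
        ((hχc n).continuous.mul (hW j).continuous).integrable_of_hasCompactSupport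
          ((hχs n).mul_right)
      simp only [hD, Finset.mul_sum]
      rw [integral_finsetSum _ fun j _ => i1 j]
      have hj : ∀ j, ∫ x, χ n x * pd (W j) j x = -∫ x, pd (χ n) j x * W j x := fun j =>
        integral_mul_fderiv_eq_neg_fderiv_mul_of_integrable (i2 j) (i1 j) (i3 j)
          (fun x _ => (hχc n).differentiable one_ne_zero x)
          (fun x _ => (hW j).differentiable one_ne_zero x)
      simp_rw [hj]
      rw [Finset.sum_neg_distrib, ← integral_finsetSum _ fun j _ => i2 j, ← integral_neg]
      congr 1
      ext x
      simp_rw [hχd]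
      have := hWq x
      calc _ = 2 * n * deriv η (n * (1 - ‖x‖ ^ 2)) * ∑ j, x j * W j x := by
            rw [Finset.mul_sum, ← Finset.sum_neg_distrib]
            exact Finset.sum_congr rfl fun j _ => by ring
        _ = _ := by rw [this]; ring
    · intro x hx
      rcases (hout n x hx).eq_or_lt with h | h
      · simp [h]
      · have : η =ᶠ[nhds (n * (1 - ‖x‖ ^ 2))] fun _ => 0 := by
          filter_upwards [Iio_mem_nhds h] with t ht
          exact Real.smoothTransition.zero_of_nonpos (le_of_lt ht)
        simp [this.deriv_eq]
  have hlarge : ∀ x ∈ 𝔹 m, ∀ᶠ n : ℕ in Filter.atTop, 1 < (n : ℝ) * (1 - ‖x‖ ^ 2) := by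
    intro x hx
    have hx' : ‖x‖ < 1 := by simpa using hx
    have : 0 < 1 - ‖x‖ ^ 2 := by nlinarith [norm_nonneg x]
    exact (tendsto_natCast_atTop_atTop.atTop_mul_const this).eventually_gt_atTop 1
  have lim1 : Filter.Tendsto (fun n => ∫ x in 𝔹 m, χ n x * D x) Filter.atTop
      (nhds (∫ x in 𝔹 m, D x)) := by
    refine tendsto_integral_of_dominated_convergence (fun x => |D x|)
      (fun n => ((hχc n).continuous.mul hDc).aestronglyMeasurable)
      hDc.abs.integrableOn_unitBall (fun n => Filter.Eventually.of_forall fun x => ?_) ?_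
    · rw [Real.norm_eq_abs, abs_mul, abs_of_nonneg (Real.smoothTransition.nonneg _)]
      exact mul_le_of_le_one_left (abs_nonneg _) (Real.smoothTransition.le_one _)
    · filter_upwards [ae_restrict_mem measurableSet_ball] with x hx
      refine tendsto_const_nhds.congr' ?_
      filter_upwards [hlarge x hx] with n hn
      simp [hχ, hη, Real.smoothTransition.one_of_one_le hn.le]
  have lim2 : Filter.Tendsto (fun n : ℕ => ∫ x in 𝔹 m,
      2 * ((n * (1 - ‖x‖ ^ 2)) * deriv η (n * (1 - ‖x‖ ^ 2))) * q x) Filter.atTop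
      (nhds (∫ _ in 𝔹 m, (0 : ℝ))) := by
    obtain ⟨C, hC⟩ := exists_bound_mul_deriv_smoothTransition
    have hin : ∀ n : ℕ, Continuous fun x : 𝔼 m => (n : ℝ) * (1 - ‖x‖ ^ 2) := fun n => by
      fun_prop
    refine tendsto_integral_of_dominated_convergence (fun x => 2 * C * |q x|)
      (fun n => ((continuous_const.mul ((hin n).mul
        ((hηc.continuous_deriv le_rfl).comp (hin n)))).mul hq).aestronglyMeasurable)
      (continuous_const.mul hq.abs).integrableOn_unitBall
      (fun n => Filter.Eventually.of_forall fun x => ?_) ?_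
    · rw [Real.norm_eq_abs, abs_mul, abs_mul, abs_two]
      gcongr
      exact hC _
    · filter_upwards [ae_restrict_mem measurableSet_ball] with x hx
      refine tendsto_const_nhds.congr' ?_
      filter_upwards [hlarge x hx] with n hn
      have : η =ᶠ[nhds (n * (1 - ‖x‖ ^ 2))] fun _ => 1 := by
        filter_upwards [Ioi_mem_nhds hn] with t ht
        exact Real.smoothTransition.one_of_one_le (le_of_lt ht)
      simp [this.deriv_eq]
  simp_rw [key] at lim1
  simpa using tendsto_nhds_unique lim1 lim2

/-- The divergence theorem on the unit ball of Euclidean space. -/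
theorem integral_unitBall_div {m : ℕ} (hm : 0 < m) {F : Fin m → (𝔼 m) → ℝ}
    (hF : ∀ j, ContDiff ℝ 1 (F j)) :
    ∫ x in 𝔹 m, ∑ j, pd (F j) j x
      = ∫ θ : 𝕊 m, (∑ j, (θ : 𝔼 m) j * F j θ) ∂(sphereMeasure m) := by
  set p : (𝔼 m) → ℝ := fun x => ∑ j, x j * F j x with hp
  have hpc : ContDiff ℝ 1 p := ContDiff.sum fun j _ => (contDiff_coord j).mul (hF j)
  have hpd := hpc.differentiable one_ne_zero
  have hWc : ∀ j, ContDiff ℝ 1 fun x : 𝔼 m => F j x - x j * p x := fun j =>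
    (hF j).sub ((contDiff_coord j).mul hpc)
  have h0 := integral_unitBall_div_eq_zero hWc hpc.continuous fun x => by
    rw [EuclideanSpace.norm_sq_eq]
    simp only [Real.norm_eq_abs, sq_abs]
    simp only [mul_sub, Finset.sum_sub_distrib, hp, sub_mul, one_mul, ← mul_assoc,
      ← Finset.sum_mul]
    simp only [← sq]
  rw [← integral_unitBall_radial hm hpc, ← sub_eq_zero, ← h0, ← integral_sub]
  · congr 1
    ext x
    have : ∀ j, pd (fun x : 𝔼 m => F j x - x j * p x) j x
        = pd (F j) j x - (x j * pd p j x + p x) := by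
      intro j
      rw [pd_sub ((hF j).differentiable one_ne_zero x) ((differentiable_coord j x).fun_mul (hpd x)),
        pd_mul (differentiable_coord j x) (hpd x), pd_coord]
      simp
    simp_rw [this]
    rw [Finset.sum_sub_distrib, Finset.sum_add_distrib]
    simp
    ring
  · exact (continuous_finsetSum _ fun j _ => continuous_pd (hF j) j).integrableOn_unitBall
  · exact ((continuous_const.mul hpc.continuous).add (continuous_finsetSum _ fun j _ =>
      (contDiff_coord (n := 0) j).continuous.mul (continuous_pd hpc j))).integrableOn_unitBall

theorem pd_comm {m : ℕ} {p : (𝔼 m) → ℝ} (hp : ContDiff ℝ 2 p) (i j : Fin m) (x : 𝔼 m) :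
    pd (pd p i) j x = pd (pd p j) i x := by
  have hd : DifferentiableAt ℝ (fderiv ℝ p) x :=
    (hp.fderiv_right (m := 1) (by norm_num)).differentiable one_ne_zero x
  have h : ∀ v w : 𝔼 m, fderiv ℝ (fun y => fderiv ℝ p y v) x w
      = fderiv ℝ (fderiv ℝ p) x w v := by
    intro v w
    rw [fderiv_clm_apply hd (differentiableAt_const v)]
    simp
  simp only [pd]
  unfold pd
  rw [h, h]
  exact (hp.contDiffAt.isSymmSndFDerivAt (by simp)).eq _ _

/-- A smooth harmonic function on `ℝ^m` satisfying Euler's identity for degree `a`. -/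
structure IsSolidHarmonic {m : ℕ} (a : ℝ) (p : (𝔼 m) → ℝ) : Prop where
  contDiff : ContDiff ℝ (⊤ : ℕ∞) p
  euler : ∀ u, ∑ j, u j * pd p j u = a * p u
  harmonic : ∀ u, ∑ j, pd (pd p j) j u = 0

namespace IsSolidHarmonic

variable {m : ℕ} {a b : ℝ} {p q : (𝔼 m) → ℝ}

theorem contDiff_partialDeriv (hp : IsSolidHarmonic a p) (i : Fin m) :
    ContDiff ℝ (⊤ : ℕ∞) (pd p i) :=
  contDiff_pd (hp.contDiff.of_le (by simp)) i

theorem differentiable (hp : IsSolidHarmonic a p) : Differentiable ℝ p :=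
  hp.contDiff.differentiable (by simp)

theorem differentiable_partialDeriv (hp : IsSolidHarmonic a p) (i : Fin m) : Differentiable ℝ (pd p i) :=
  (hp.contDiff_partialDeriv i).differentiable (by simp)

theorem partialDeriv (hp : IsSolidHarmonic a p) (i : Fin m) : IsSolidHarmonic (a - 1) (pd p i) where
  contDiff := hp.contDiff_partialDeriv i
  euler u := by
    have h : pd (fun u => ∑ j, u j * pd p j u) i u
        = pd (fun u => a * p u) i u := by
      congr 1
      exact funext hp.euler
    rw [pd_const_mul (hp.differentiable u),
      pd_sum fun j _ => (differentiable_coord j u).fun_mul (hp.differentiable_partialDeriv j u)] at h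
    simp_rw [pd_mul (differentiable_coord _ u) (hp.differentiable_partialDeriv _ u), pd_coord,
      Finset.sum_add_distrib] at h
    simp only [ite_mul, one_mul, zero_mul, Finset.sum_ite_eq', Finset.mem_univ, if_true] at h
    simp_rw [pd_comm (contDiff_infty.1 hp.contDiff 2) i]
    linarith
  harmonic u := by
    have h2 : ∀ j, pd (pd p i) j = pd (pd p j) i := fun j =>
      funext fun v => pd_comm (contDiff_infty.1 hp.contDiff 2) i j v
    have h3 : ∀ j, pd (pd (pd p j) i) j u
        = pd (pd (pd p j) j) i u := fun j =>
      pd_comm (contDiff_infty.1 (hp.contDiff_partialDeriv j) 2) i j u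
    have h4 : ∀ j, DifferentiableAt ℝ (pd (pd p j) j) u := fun j =>
      (contDiff_pd (n := 1)
        (contDiff_infty.1 (hp.contDiff_partialDeriv j) 2) j).differentiable one_ne_zero u
    simp_rw [h2, h3]
    rw [← pd_sum fun j _ => h4 j, funext hp.harmonic]
    simp [pd]

theorem sum {ι : Type*} {s : Finset ι} {P : ι → (𝔼 m) → ℝ}
    (h : ∀ i ∈ s, IsSolidHarmonic a (P i)) : IsSolidHarmonic a (fun u => ∑ i ∈ s, P i u) where
  contDiff := ContDiff.sum fun i hi => (h i hi).contDiff
  euler u := by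
    simp_rw [pd_sum fun i hi => (h i hi).differentiable u, Finset.mul_sum]
    rw [Finset.sum_comm]
    exact Finset.sum_congr rfl fun i hi => (h i hi).euler u
  harmonic u := by
    have h1 : ∀ j, pd (fun u => ∑ i ∈ s, P i u) j
        = fun u => ∑ i ∈ s, pd (P i) j u := fun j =>
      funext fun v => pd_sum (fun i hi => (h i hi).differentiable v) j
    simp_rw [h1]
    simp_rw [pd_sum fun i hi => (h i hi).differentiable_partialDeriv _ u]
    rw [Finset.sum_comm]
    exact Finset.sum_eq_zero fun i hi => (h i hi).harmonic u

/-- Solid harmonics of different degrees are orthogonal on the unit sphere. -/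
theorem integral_sphere_mul_eq_zero (hm : 0 < m) (hp : IsSolidHarmonic a p)
    (hq : IsSolidHarmonic b q) (hab : a ≠ b) :
    ∫ u : 𝕊 m, p u * q u ∂(sphereMeasure m) = 0 := by
  have hF : ∀ j, ContDiff ℝ 1 fun u => pd p j u * q u - p u * pd q j u := fun j =>
    (((hp.contDiff_partialDeriv j).mul hq.contDiff).sub (hp.contDiff.mul (hq.contDiff_partialDeriv j))).of_le
      (by exact_mod_cast le_top)
  have h := integral_unitBall_div hm hF
  have h1 : ∀ u : 𝔼 m,
      ∑ j, pd (fun u => pd p j u * q u - p u * pd q j u) j u = 0 := by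
    intro u
    have : ∀ j, pd (fun u => pd p j u * q u - p u * pd q j u) j u
        = pd (pd p j) j u * q u - p u * pd (pd q j) j u := by
      intro j
      rw [pd_sub ((hp.differentiable_partialDeriv j u).fun_mul (hq.differentiable u))
          ((hp.differentiable u).fun_mul (hq.differentiable_partialDeriv j u)),
        pd_mul (hp.differentiable_partialDeriv j u) (hq.differentiable u),
        pd_mul (hp.differentiable u) (hq.differentiable_partialDeriv j u)]
      ring
    simp_rw [this]
    rw [Finset.sum_sub_distrib, ← Finset.sum_mul, ← Finset.mul_sum, hp.harmonic, hq.harmonic]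
    simp
  have h2 : ∀ u : 𝔼 m, ∑ j, u j * (pd p j u * q u - p u * pd q j u)
      = (a - b) * (p u * q u) := by
    intro u
    have h3 := hp.euler u
    have h4 := hq.euler u
    calc _ = (∑ j, u j * pd p j u) * q u - p u * ∑ j, u j * pd q j u := by
          rw [Finset.sum_mul, Finset.mul_sum, ← Finset.sum_sub_distrib]
          exact Finset.sum_congr rfl fun j _ => by ring
      _ = _ := by rw [h3, h4]; ring
  simp_rw [h1, h2] at h
  rw [integral_const_mul] at h
  simpa [sub_ne_zero.2 hab] using h.symm

/-- On the unit sphere, multiplication by a coordinate is adjoint, up to a factor, to the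
corresponding partial derivative. -/
theorem integral_sphere_coord_mul (hm : 0 < m) (hp : IsSolidHarmonic a p)
    (hq : IsSolidHarmonic (a - 1) q) (i : Fin m) :
    (m + 2 * a - 2) * ∫ u : 𝕊 m, (u : 𝔼 m) i * (q u * p u) ∂(sphereMeasure m)
      = ∫ u : 𝕊 m, q u * pd p i u ∂(sphereMeasure m) := by
  have hpq : ContDiff ℝ (⊤ : ℕ∞) fun u => q u * p u := hq.contDiff.mul hp.contDiff
  set h : (𝔼 m) → ℝ := fun u => q u * pd p i u + pd q i u * p u with hh
  have hpd : ∀ u, pd (fun u => q u * p u) i u = h u := fun u =>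
    pd_mul (hq.differentiable u) (hp.differentiable u) i
  have hhc : ContDiff ℝ 1 h :=
    ((hq.contDiff.mul (hp.contDiff_partialDeriv i)).add ((hq.contDiff_partialDeriv i).mul hp.contDiff)).of_le
      (by exact_mod_cast le_top)
  have hrad : ∀ u : 𝔼 m, m * h u + ∑ j, u j * pd h j u = (m + 2 * a - 2) * h u := by
    intro u
    have hj : ∀ j, pd h j u
        = (q u * pd (pd p i) j u + pd q j u * pd p i u)
          + (pd q i u * pd p j u + pd (pd q i) j u * p u) := by
      intro j
      rw [← pd_mul (hq.differentiable u) (hp.differentiable_partialDeriv i u),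
        ← pd_mul (hq.differentiable_partialDeriv i u) (hp.differentiable u)]
      unfold pd
      rw [hh, fderiv_fun_add ((hq.differentiable u).fun_mul (hp.differentiable_partialDeriv i u))
        ((hq.differentiable_partialDeriv i u).fun_mul (hp.differentiable u))]
      rfl
    have e1 := hp.euler u
    have e2 := hq.euler u
    have e3 := (hp.partialDeriv i).euler u
    have e4 := (hq.partialDeriv i).euler u
    have : ∑ j, u j * pd h j u
        = q u * (∑ j, u j * pd (pd p i) j u)
          + (∑ j, u j * pd q j u) * pd p i u
          + pd q i u * (∑ j, u j * pd p j u)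
          + (∑ j, u j * pd (pd q i) j u) * p u := by
      simp only [hj, Finset.mul_sum, Finset.sum_mul, ← Finset.sum_add_distrib]
      exact Finset.sum_congr rfl fun j _ => by ring
    rw [this, e1, e2, e3, e4, hh]
    ring
  have hdiv := integral_unitBall_div hm (F := fun j u => if j = i then q u * p u else 0)
    fun j => by
      by_cases hji : j = i
      · simpa [hji] using hpq.of_le (by exact_mod_cast le_top)
      · simpa [hji] using contDiff_const
  have hsum : ∀ u : 𝔼 m,
      ∑ j, pd (fun u => if j = i then q u * p u else 0) j u = h u := by
    intro u
    rw [Finset.sum_eq_single i, ← hpd]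
    · simp
    · intro j _ hji
      simp [hji, pd]
    · simp
  simp only [hsum, mul_ite, mul_zero, Finset.sum_ite_eq', Finset.mem_univ, if_true] at hdiv
  have hR := integral_unitBall_radial hm hhc
  simp_rw [hrad] at hR
  rw [integral_const_mul] at hR
  rw [← hdiv, hR, hh, integral_add, (hq.partialDeriv i).integral_sphere_mul_eq_zero hm hp (by linarith),
    add_zero]
  · exact (hq.contDiff.mul (hp.contDiff_partialDeriv i)).continuous.integrable_sphere
  · exact ((hq.contDiff_partialDeriv i).mul hp.contDiff).continuous.integrable_sphere

end IsSolidHarmonic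

/-- Finite sums of products `c(x) P(u)` with `c` of class `C^n` and `P` smooth. -/
def IsSeparatedSum {m : ℕ} (n : ℕ) (f : (𝔼 m) → (𝔼 m) → ℝ) : Prop :=
  ∃ (ι : Type) (_ : Fintype ι) (c P : ι → (𝔼 m) → ℝ), (∀ a, ContDiff ℝ n (c a)) ∧
    (∀ a, ContDiff ℝ (⊤ : ℕ∞) (P a)) ∧ ∀ x u, f x u = ∑ a, c a x * P a u

namespace IsSeparatedSum

variable {m n : ℕ} {f : (𝔼 m) → (𝔼 m) → ℝ}

theorem mono {l : ℕ} (hf : IsSeparatedSum n f) (h : l ≤ n) : IsSeparatedSum l f := by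
  obtain ⟨ι, _, c, P, hc, hP, hf⟩ := hf
  exact ⟨ι, ‹_›, c, P, fun a => (hc a).of_le (by exact_mod_cast h), hP, hf⟩

theorem contDiff_left (hf : IsSeparatedSum n f) (u : 𝔼 m) : ContDiff ℝ n fun x => f x u := by
  obtain ⟨ι, _, c, P, hc, hP, hf⟩ := hf
  simp_rw [hf]
  exact ContDiff.sum fun a _ => (hc a).mul contDiff_const

theorem differentiable_left (hf : IsSeparatedSum (n + 1) f) (u : 𝔼 m) :
    Differentiable ℝ fun x => f x u :=
  (hf.contDiff_left u).differentiable (by simp)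

theorem contDiff_right (hf : IsSeparatedSum n f) (x : 𝔼 m) : ContDiff ℝ (⊤ : ℕ∞) (f x) := by
  obtain ⟨ι, _, c, P, hc, hP, hf⟩ := hf
  rw [funext (hf x)]
  exact ContDiff.sum fun a _ => contDiff_const.mul (hP a)

theorem continuous (hf : IsSeparatedSum n f) : Continuous fun z : (𝔼 m) × (𝔼 m) => f z.1 z.2 := by
  obtain ⟨ι, _, c, P, hc, hP, hf⟩ := hf
  simp_rw [hf]
  exact continuous_finsetSum _ fun a _ =>
    ((hc a).continuous.comp continuous_fst).mul ((hP a).continuous.comp continuous_snd)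

theorem partialX (hf : IsSeparatedSum (n + 1) f) (i : Fin m) : IsSeparatedSum n (pdx f i) := by
  obtain ⟨ι, _, c, P, hc, hP, hf⟩ := hf
  refine ⟨ι, ‹_›, fun a => pd (c a) i, P, fun a => contDiff_pd (hc a) i, hP, fun x u => ?_⟩
  have hd : ∀ a, DifferentiableAt ℝ (c a) x := fun a => (hc a).differentiable (by simp) x
  change pd (fun x => f x u) i x = _
  simp_rw [hf]
  rw [pd_sum fun a _ => (hd a).fun_mul (differentiableAt_const _)]
  simp_rw [pd_mul_const (hd _)]

theorem partialU (hf : IsSeparatedSum n f) (i : Fin m) : IsSeparatedSum n (pdu f i) := by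
  obtain ⟨ι, _, c, P, hc, hP, hf⟩ := hf
  refine ⟨ι, ‹_›, c, fun a => pd (P a) i, hc,
    fun a => contDiff_pd ((hP a).of_le (by simp)) i, fun x u => ?_⟩
  have hd : ∀ a, DifferentiableAt ℝ (P a) u := fun a => (hP a).differentiable (by simp) u
  change pd (f x) i u = _
  rw [funext (hf x), pd_sum fun a _ => (differentiableAt_const _).fun_mul (hd a)]
  simp_rw [pd_const_mul (hd _)]

theorem sum {κ : Type} [Fintype κ] {F : κ → (𝔼 m) → (𝔼 m) → ℝ}
    (h : ∀ b, IsSeparatedSum n (F b)) : IsSeparatedSum n fun x u => ∑ b, F b x u := by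
  choose ι hι c P hc hP hf using h
  refine ⟨Σ b, ι b, inferInstance, fun a => c a.1 a.2, fun a => P a.1 a.2, fun a => hc _ _,
    fun a => hP _ _, fun x u => ?_⟩
  simp_rw [hf]
  rw [Fintype.sum_sigma]

theorem pdx_pdu (hf : IsSeparatedSum 1 f) (i j : Fin m) (x u : 𝔼 m) :
    pdx (pdu f j) i x u = pdu (pdx f i) j x u := by
  obtain ⟨ι, _, c, P, hc, hP, hf⟩ := hf
  have hd : ∀ a x, DifferentiableAt ℝ (c a) x := fun a x => (hc a).differentiable (by simp) x
  have hd' : ∀ a u, DifferentiableAt ℝ (P a) u := fun a u => (hP a).differentiable (by simp) u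
  have h1 : ∀ x u, pdu f j x u = ∑ a, c a x * pd (P a) j u := fun x u => by
    change pd (f x) j u = _
    rw [funext (hf x), pd_sum fun a _ => (differentiableAt_const _).fun_mul (hd' a u)]
    simp_rw [pd_const_mul (hd' _ u)]
  have h2 : ∀ x u, pdx f i x u = ∑ a, pd (c a) i x * P a u := fun x u => by
    change pd (fun x => f x u) i x = _
    simp_rw [hf]
    rw [pd_sum fun a _ => (hd a x).fun_mul (differentiableAt_const _)]
    simp_rw [pd_mul_const (hd _ x)]
  change pd (fun x => pdu f j x u) i x = pd (pdx f i x) j u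
  simp_rw [h1]
  rw [funext (h2 x), pd_sum fun a _ => (hd a x).fun_mul (differentiableAt_const _),
    pd_sum fun a _ => (differentiableAt_const _).fun_mul (hd' a u)]
  simp_rw [pd_const_mul (hd' _ u), pd_mul_const (hd _ x)]

end IsSeparatedSum

/-- Separated sums of class `C^n` in `x` that are solid harmonics of degree `a` in `u`. -/
structure IsHarmonicField {m : ℕ} (n : ℕ) (a : ℝ) (f : (𝔼 m) → (𝔼 m) → ℝ) : Prop where
  separatedSum : IsSeparatedSum n f
  solid : ∀ x, IsSolidHarmonic a (f x)

namespace IsHarmonicField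

variable {m n : ℕ} {a : ℝ} {f : (𝔼 m) → (𝔼 m) → ℝ}

theorem partialU (hf : IsHarmonicField n a f) (i : Fin m) : IsHarmonicField n (a - 1) (pdu f i) :=
  ⟨hf.separatedSum.partialU i, fun x => (hf.solid x).partialDeriv i⟩

theorem partialX (hf : IsHarmonicField (n + 1) a f) (i : Fin m) : IsHarmonicField n a (pdx f i) := by
  have hs := hf.separatedSum
  have hs1 : IsSeparatedSum 1 f := hs.mono (by omega)
  refine ⟨hs.partialX i, fun x => ⟨(hs.partialX i).contDiff_right x, fun u => ?_, fun u => ?_⟩⟩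
  · have h1 : ∀ j, pd (pdx f i x) j u = pd (fun x => pdu f j x u) i x := fun j =>
      (hs1.pdx_pdu i j x u).symm
    have hd : ∀ j, DifferentiableAt ℝ (fun x => pdu f j x u) x := fun j =>
      (hs.partialU j).differentiable_left u x
    simp_rw [h1, ← pd_const_mul (hd _)]
    rw [← pd_sum fun j _ => (hd j).const_mul _]
    have : (fun x => ∑ j, u j * pdu f j x u) = fun x => a * f x u :=
      funext fun x => (hf.solid x).euler u
    rw [this, pd_const_mul (hs.differentiable_left u x)]
    rfl
  · have h1 : ∀ j, pd (pd (pdx f i x) j) j u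
        = pd (fun x => pdu (pdu f j) j x u) i x := fun j => by
      have : pd (pdx f i x) j = pdx (pdu f j) i x :=
        funext fun v => (hs1.pdx_pdu i j x v).symm
      rw [this]
      exact ((hs1.partialU j).pdx_pdu i j x u).symm
    simp_rw [h1]
    rw [← pd_sum fun j _ => ((hs.partialU j).partialU j).differentiable_left u x]
    have : (fun x => ∑ j, pdu (pdu f j) j x u) = fun _ => 0 :=
      funext fun x => (hf.solid x).harmonic u
    rw [this]
    simp [pd]

theorem sum {κ : Type} [Fintype κ] {F : κ → (𝔼 m) → (𝔼 m) → ℝ}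
    (h : ∀ b, IsHarmonicField n a (F b)) : IsHarmonicField n a fun x u => ∑ b, F b x u :=
  ⟨IsSeparatedSum.sum fun b => (h b).separatedSum, fun x => IsSolidHarmonic.sum fun b _ => (h b).solid x⟩

end IsHarmonicField

theorem ValuesInHk.isHarmonicField {m k n : ℕ} {f : (𝔼 m) → (𝔼 m) → ℝ}
    (hf : ValuesInHk m k (fun c => ContDiff ℝ n c) f) : IsHarmonicField n k f := by
  obtain ⟨⟨s, c, hs, hc, hfx⟩, hharm⟩ := hf
  have hsep : IsSeparatedSum n f := by
    refine ⟨s, inferInstance, fun α => c α, fun α u => ∏ i, (u i) ^ (α.1 i), fun α => hc _ α.2,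
      fun α => contDiff_prod fun i _ => (contDiff_coord i).pow _, fun x u => ?_⟩
    rw [hfx, ← Finset.sum_coe_sort s]
  refine ⟨hsep, fun x => ⟨hsep.contDiff_right x, fun u => ?_, fun u => hharm x u⟩⟩
  have hhom : ∀ t : ℝ, f x (t • u) = t ^ k * f x u := by
    intro t
    rw [hfx, hfx, Finset.mul_sum]
    refine Finset.sum_congr rfl fun α hα => ?_
    simp only [PiLp.smul_apply, smul_eq_mul, mul_pow, Finset.prod_mul_distrib,
      Finset.prod_pow_eq_pow_sum, hs α hα]
    ring
  have h1 : HasDerivAt (fun t : ℝ => t • u) u 1 := by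
    simpa using (hasDerivAt_id (1 : ℝ)).smul_const u
  have hd : DifferentiableAt ℝ (f x) ((1 : ℝ) • u) :=
    (hsep.contDiff_right x).differentiable (by simp) _
  have h2 := hd.hasFDerivAt.comp_hasDerivAt (1 : ℝ) h1
  have h3 : HasDerivAt (fun t : ℝ => t ^ k * f x u) (k * f x u) 1 := by
    simpa using (hasDerivAt_pow k (1 : ℝ)).mul_const (f x u)
  have h4 : f x ∘ (fun t : ℝ => t • u) = fun t => t ^ k * f x u := funext hhom
  rw [h4] at h2
  rw [← h2.unique h3, one_smul, fderiv_apply_eq_sum_pd]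

/-- The operator `⟨D_u, D_x⟩`. -/
def mixedDiv {m : ℕ} (f : (𝔼 m) → (𝔼 m) → ℝ) : (𝔼 m) → (𝔼 m) → ℝ :=
  fun x u => ∑ j, pdu (pdx f j) j x u

/-- The `i`-th component of the flux whose divergence appears in Green's formula for `D_k`. -/
def greenFlux {m : ℕ} (c : ℝ) (f g : (𝔼 m) → (𝔼 m) → ℝ) (i : Fin m) : (𝔼 m) → (𝔼 m) → ℝ :=
  fun x u => pdx f i x u * g x u - c * u i * (mixedDiv f x u * g x u)

/-- The divergence in `x` of `greenFlux`, written out. -/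
def greenFluxDiv {m : ℕ} (c : ℝ) (f g : (𝔼 m) → (𝔼 m) → ℝ) : (𝔼 m) → (𝔼 m) → ℝ :=
  fun x u => ∑ i, (pdx (pdx f i) i x u * g x u + pdx f i x u * pdx g i x u
    - c * u i * (pdx (mixedDiv f) i x u * g x u + mixedDiv f x u * pdx g i x u))

section

variable {m : ℕ} {a : ℝ} {f g : (𝔼 m) → (𝔼 m) → ℝ}

theorem IsHarmonicField.mixedDiv {n : ℕ} (hf : IsHarmonicField (n + 1) a f) :
    IsHarmonicField n (a - 1) (mixedDiv f) :=
  IsHarmonicField.sum fun j => (hf.partialX j).partialU j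

theorem contDiff_greenFlux (c : ℝ) (hf : IsHarmonicField 2 a f) (hg : IsHarmonicField 2 a g)
    (i : Fin m) (u : 𝔼 m) : ContDiff ℝ 1 fun x => greenFlux c f g i x u := by
  have h1 := (hf.partialX i).separatedSum.contDiff_left u
  have h2 := (hg.separatedSum.mono one_le_two).contDiff_left u
  have h3 := hf.mixedDiv.separatedSum.contDiff_left u
  exact (h1.mul h2).sub (contDiff_const.mul (h3.mul h2))

theorem sum_pd_greenFlux (c : ℝ) (hf : IsHarmonicField 2 a f) (hg : IsHarmonicField 2 a g)
    (x u : 𝔼 m) : ∑ i, pd (fun x => greenFlux c f g i x u) i x = greenFluxDiv c f g x u := by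
  refine Finset.sum_congr rfl fun i _ => ?_
  have h1 := (hf.partialX i).separatedSum.differentiable_left u x
  have h2 := hg.separatedSum.differentiable_left u x
  have h3 := hf.mixedDiv.separatedSum.differentiable_left u x
  unfold greenFlux
  rw [pd_sub (h1.fun_mul h2) ((h3.fun_mul h2).const_mul _), pd_const_mul (h3.fun_mul h2),
    pd_mul h1 h2, pd_mul h3 h2]
  simp only [pdx, pd]
  ring

theorem continuous_greenFlux (c : ℝ) (hf : IsHarmonicField 2 a f) (hg : IsHarmonicField 2 a g)
    (i : Fin m) : Continuous fun z : (𝔼 m) × (𝔼 m) => greenFlux c f g i z.1 z.2 := by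
  have h1 := (hf.partialX i).separatedSum.continuous
  have h2 := hg.separatedSum.continuous
  have h3 := hf.mixedDiv.separatedSum.continuous
  unfold greenFlux
  fun_prop

theorem continuous_greenFluxDiv (c : ℝ) (hf : IsHarmonicField 2 a f)
    (hg : IsHarmonicField 2 a g) :
    Continuous fun z : (𝔼 m) × (𝔼 m) => greenFluxDiv c f g z.1 z.2 := by
  refine continuous_finsetSum _ fun i _ => ?_
  have h0 := ((hf.partialX i).partialX i).separatedSum.continuous
  have h1 := (hf.partialX i).separatedSum.continuous
  have h2 := hg.separatedSum.continuous
  have h3 := hf.mixedDiv.separatedSum.continuous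
  have h4 := (hf.mixedDiv.partialX i).separatedSum.continuous
  have h5 := (hg.partialX i).separatedSum.continuous
  fun_prop

theorem boundaryOp_mul {k : ℕ} (x u : 𝔼 m) :
    boundaryOp m k f x u * g x u
      = ∑ j, x j * greenFlux (4 / ((m : ℝ) + 2 * k - 2)) f g j x u := by
  have hi : ⟪u, x⟫ = ∑ j, x j * u j := by simp [PiLp.inner_apply]
  have h : boundaryOp m k f x u = (∑ j, x j * pdx f j x u)
      - (4 / ((m : ℝ) + 2 * k - 2)) * (∑ j, x j * u j) * mixedDiv f x u := by
    rw [← hi]; rfl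
  rw [h]
  simp only [greenFlux, mul_sub, Finset.sum_sub_distrib, sub_mul, Finset.mul_sum, Finset.sum_mul]
  congr 1 <;> exact Finset.sum_congr rfl fun j _ => by ring

/-- On the sphere, `D_k f` differs from an expression in divergence form by a term orthogonal
to the solid harmonics of degree `k`. -/
theorem integral_sphere_bosonicLaplacian_mul {k : ℕ} (hm : 3 ≤ m) (hk : 1 ≤ k)
    (hf : IsHarmonicField 2 k f) (hg : IsHarmonicField 2 k g) (x : 𝔼 m) :
    Integrable (fun u : 𝕊 m => bosonicLaplacian m k f x u * g x u) (sphereMeasure m) ∧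
    ∫ u : 𝕊 m, bosonicLaplacian m k f x u * g x u ∂(sphereMeasure m)
      = ∫ u : 𝕊 m, (greenFluxDiv (4 / ((m : ℝ) + 2 * k - 2)) f g x u
          - ∑ i, pdx f i x u * pdx g i x u) ∂(sphereMeasure m)
        + 4 / ((m : ℝ) + 2 * k - 2) ^ 2
          * ∫ u : 𝕊 m, mixedDiv f x u * mixedDiv g x u ∂(sphereMeasure m) := by
  have hm0 : 0 < m := by omega
  have hpos : (m : ℝ) + 2 * k - 2 ≠ 0 := by
    have h1 : (3 : ℝ) ≤ m := by exact_mod_cast hm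
    have h2 : (1 : ℝ) ≤ k := by exact_mod_cast hk
    exact (by linarith : (0 : ℝ) < m + 2 * k - 2).ne'
  set c : ℝ := 4 / ((m : ℝ) + 2 * k - 2) with hc
  set d : ℝ := 4 / (((m : ℝ) + 2 * k - 2) * ((m : ℝ) + 2 * k - 4)) with hd
  set Q : (𝔼 m) → (𝔼 m) → ℝ :=
    fun x u => ∑ i, ∑ j, pdu (pdu (pdx (pdx f j) i) j) i x u with hQ
  have hQh : IsHarmonicField 0 ((k : ℝ) - 1 - 1) Q := IsHarmonicField.sum fun i =>
    IsHarmonicField.sum fun j => (((hf.partialX j).partialX i).partialU j).partialU i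
  have hE := hf.mixedDiv
  have hsplit : ∀ u : 𝕊 m, bosonicLaplacian m k f x u * g x u
      = (greenFluxDiv c f g x u - ∑ i, pdx f i x u * pdx g i x u)
        + (d * (Q x u * g x u)
          + c * ∑ i, (u : 𝔼 m) i * (mixedDiv f x u * pdx g i x u)) := by
    intro u
    have hu : ‖(u : 𝔼 m)‖ = 1 := by simp
    have hswap : ∀ i, pdx (mixedDiv f) i x u = ∑ j, pdu (pdx (pdx f j) i) j x u := by
      intro i
      have hdf : ∀ j, DifferentiableAt ℝ (fun x => pdu (pdx f j) j x u) x := fun j =>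
        ((hf.partialX j).partialU j).separatedSum.differentiable_left u x
      change pd (fun x => ∑ j, pdu (pdx f j) j x u) i x = _
      rw [pd_sum fun j _ => hdf j]
      exact Finset.sum_congr rfl fun j _ => (hf.partialX j).separatedSum.pdx_pdu i j x u
    simp only [bosonicLaplacian, greenFluxDiv, hu, hswap, one_pow, mul_one, ← hc, ← hd, hQ,
      ← Finset.mul_sum]
    simp only [mul_add, ← mul_assoc, Finset.sum_add_distrib, Finset.sum_sub_distrib,
      ← Finset.sum_mul, sub_mul, add_mul]
    simp only [mul_assoc, ← Finset.mul_sum]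
    ring
  have hgc := (hg.solid x).contDiff.continuous
  have hpair : Continuous fun u : 𝔼 m => ((x, u) : (𝔼 m) × (𝔼 m)) := by fun_prop
  have hEc := (hE.solid x).contDiff.continuous
  have hXf : ∀ i, Continuous (pdx f i x) := fun i =>
    ((hf.partialX i).solid x).contDiff.continuous
  have hXg : ∀ i, Continuous (pdx g i x) := fun i =>
    ((hg.partialX i).solid x).contDiff.continuous
  have i1 : Integrable (fun u : 𝕊 m => greenFluxDiv c f g x u - ∑ i, pdx f i x u * pdx g i x u)
      (sphereMeasure m) :=
    Continuous.integrable_sphere (w := fun u => greenFluxDiv c f g x u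
      - ∑ i, pdx f i x u * pdx g i x u) <|
      ((continuous_greenFluxDiv c hf hg).comp hpair).sub <|
        continuous_finsetSum _ fun i _ => (hXf i).mul (hXg i)
  have i2 : Integrable (fun u : 𝕊 m => d * (Q x u * g x u)) (sphereMeasure m) :=
    ((hQh.solid x).contDiff.continuous.mul hgc).integrable_sphere.const_mul d
  have i3 : ∀ i, Integrable (fun u : 𝕊 m => (u : 𝔼 m) i * (mixedDiv f x u * pdx g i x u))
      (sphereMeasure m) := fun i =>
    ((contDiff_coord (n := 0) i).continuous.mul (hEc.mul (hXg i))).integrable_sphere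
  have i4 : Integrable (fun u : 𝕊 m => c * ∑ i, (u : 𝔼 m) i * (mixedDiv f x u * pdx g i x u))
      (sphereMeasure m) := (integrable_finsetSum _ fun i _ => i3 i).const_mul c
  have i5 : Integrable (fun u : 𝕊 m => d * (Q x u * g x u)
      + c * ∑ i, (u : 𝔼 m) i * (mixedDiv f x u * pdx g i x u)) (sphereMeasure m) := i2.add i4
  refine ⟨(i1.add i5).congr (Filter.Eventually.of_forall fun u => (hsplit u).symm), ?_⟩
  simp_rw [hsplit]
  rw [integral_add i1 i5, integral_add i2 i4, integral_const_mul, integral_const_mul,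
    integral_finsetSum _ fun i _ => i3 i,
    (hQh.solid x).integral_sphere_mul_eq_zero hm0 (hg.solid x) (by linarith)]
  have hadj : ∀ i, ∫ u : 𝕊 m, (u : 𝔼 m) i * (mixedDiv f x u * pdx g i x u) ∂(sphereMeasure m)
      = ((m : ℝ) + 2 * k - 2)⁻¹
        * ∫ u : 𝕊 m, mixedDiv f x u * pdu (pdx g i) i x u ∂(sphereMeasure m) := by
    intro i
    have := ((hg.partialX i).solid x).integral_sphere_coord_mul hm0 (hE.solid x) i
    change _ = ∫ u : 𝕊 m, mixedDiv f x u * pdu (pdx g i) i x u ∂(sphereMeasure m) at this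
    rw [← this, inv_mul_cancel_left₀ hpos]
  simp_rw [hadj]
  rw [← Finset.mul_sum, ← integral_finsetSum]
  · simp_rw [← Finset.mul_sum]
    change _ + (_ + c * (_ * ∫ u : 𝕊 m, mixedDiv f x u * mixedDiv g x u ∂(sphereMeasure m))) = _
    rw [hc]
    field_simp
    ring
  · intro i _
    exact (hEc.mul (((hg.partialX i).partialU i).solid x).contDiff.continuous).integrable_sphere

theorem integrable_ball_prod_sphere {w : (𝔼 m) × (𝔼 m) → ℝ} (hw : Continuous w) :
    Integrable (fun z : (𝔼 m) × (𝕊 m) => w (z.1, z.2))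
      ((volume.restrict (𝔹 m)).prod (sphereMeasure m)) := by
  have hc : Continuous fun z : (𝔼 m) × (𝕊 m) => w (z.1, z.2) := by fun_prop
  have h := (hc.continuousOn (s := Metric.closedBall 0 1 ×ˢ Set.univ)).integrableOn_compact
    (μ := volume.prod (sphereMeasure m)) ((isCompact_closedBall 0 1).prod isCompact_univ)
  have h' := h.mono_set (Set.prod_mono_left (t := Set.univ)
    (Metric.ball_subset_closedBall (x := (0 : 𝔼 m)) (ε := 1)))
  rwa [IntegrableOn, ← Measure.prod_restrict, Measure.restrict_univ] at h'

theorem integrable_sphere_prod_sphere {w : (𝔼 m) × (𝔼 m) → ℝ} (hw : Continuous w) :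
    Integrable (fun z : (𝕊 m) × (𝕊 m) => w (z.1, z.2))
      ((sphereMeasure m).prod (sphereMeasure m)) := by
  have hc : Continuous fun z : (𝕊 m) × (𝕊 m) => w (z.1, z.2) := by fun_prop
  exact hc.integrable_of_hasCompactSupport (HasCompactSupport.of_compactSpace _)

end

/-- Green's formula for the bosonic Laplacian on the unit ball (scalar-valued version):
`∫_{B₁}∫_{S^{m-1}} (D_k f) g - f (D_k g) dS(u) dx
  = ∫_{|x|=1}∫_{S^{m-1}} (A f) g - f (A g) dS(u) dσ(x)`. -/
theorem green_formula_unit_ball (m k : ℕ) (hm : 3 ≤ m) (hk : 1 ≤ k)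
    (f g : EuclideanSpace ℝ (Fin m) → EuclideanSpace ℝ (Fin m) → ℝ)
    (hf : ValuesInHk m k (fun c => ContDiff ℝ 2 c) f)
    (hg : ValuesInHk m k (fun c => ContDiff ℝ 2 c) g) :
    (∫ x in Metric.ball (0 : EuclideanSpace ℝ (Fin m)) 1,
      ∫ u : Metric.sphere (0 : EuclideanSpace ℝ (Fin m)) 1,
        (bosonicLaplacian m k f x (u : EuclideanSpace ℝ (Fin m)) *
            g x (u : EuclideanSpace ℝ (Fin m))
          - f x (u : EuclideanSpace ℝ (Fin m)) *
              bosonicLaplacian m k g x (u : EuclideanSpace ℝ (Fin m)))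
        ∂(sphereMeasure m))
    = ∫ x : Metric.sphere (0 : EuclideanSpace ℝ (Fin m)) 1,
        ∫ u : Metric.sphere (0 : EuclideanSpace ℝ (Fin m)) 1,
          (boundaryOp m k f (x : EuclideanSpace ℝ (Fin m)) (u : EuclideanSpace ℝ (Fin m)) *
              g (x : EuclideanSpace ℝ (Fin m)) (u : EuclideanSpace ℝ (Fin m))
            - f (x : EuclideanSpace ℝ (Fin m)) (u : EuclideanSpace ℝ (Fin m)) *
                boundaryOp m k g (x : EuclideanSpace ℝ (Fin m)) (u : EuclideanSpace ℝ (Fin m)))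
          ∂(sphereMeasure m) ∂(sphereMeasure m) := by
  replace hf := ValuesInHk.isHarmonicField (n := 2) hf
  replace hg := ValuesInHk.isHarmonicField (n := 2) hg
  have hm0 : 0 < m := by omega
  set c : ℝ := 4 / ((m : ℝ) + 2 * k - 2) with hc
  have hL : ∀ x, ∫ u : 𝕊 m, (bosonicLaplacian m k f x u * g x u
        - f x u * bosonicLaplacian m k g x u) ∂(sphereMeasure m)
      = ∫ u : 𝕊 m, (greenFluxDiv c f g x u - greenFluxDiv c g f x u) ∂(sphereMeasure m) := by
    intro x
    obtain ⟨i1, e1⟩ := integral_sphere_bosonicLaplacian_mul hm hk hf hg x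
    obtain ⟨i2, e2⟩ := integral_sphere_bosonicLaplacian_mul hm hk hg hf x
    have hpair : Continuous fun u : 𝔼 m => ((x, u) : (𝔼 m) × (𝔼 m)) := by fun_prop
    have j0 : Integrable (fun u : 𝕊 m => ∑ i, pdx f i x u * pdx g i x u) (sphereMeasure m) :=
      integrable_finsetSum _ fun i _ => (((hf.partialX i).solid x).contDiff.continuous.mul
        ((hg.partialX i).solid x).contDiff.continuous).integrable_sphere
    have j1 : Integrable (fun u : 𝕊 m => greenFluxDiv c f g x u) (sphereMeasure m) :=
      ((continuous_greenFluxDiv c hf hg).comp hpair).integrable_sphere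
    have j2 : Integrable (fun u : 𝕊 m => greenFluxDiv c g f x u) (sphereMeasure m) :=
      ((continuous_greenFluxDiv c hg hf).comp hpair).integrable_sphere
    simp_rw [mul_comm (f x _) (bosonicLaplacian m k g x _)]
    simp_rw [mul_comm (pdx g _ x _) (pdx f _ x _), mul_comm (mixedDiv g x _)] at e2
    rw [integral_sub i1 i2, e1, e2, integral_sub j1 j0, integral_sub j2 j0, integral_sub j1 j2]
    ring
  have hR : ∀ x u : 𝔼 m, boundaryOp m k f x u * g x u - f x u * boundaryOp m k g x u
      = ∑ j, x j * (greenFlux c f g j x u - greenFlux c g f j x u) := by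
    intro x u
    rw [mul_comm (f x u), boundaryOp_mul, boundaryOp_mul, ← Finset.sum_sub_distrib]
    exact Finset.sum_congr rfl fun j _ => by ring
  have hdiv : ∀ u : 𝔼 m, ∫ x in 𝔹 m, (greenFluxDiv c f g x u - greenFluxDiv c g f x u)
      = ∫ x : 𝕊 m, (∑ j, (x : 𝔼 m) j * (greenFlux c f g j x u - greenFlux c g f j x u))
          ∂(sphereMeasure m) := by
    intro u
    have h1 := fun j => contDiff_greenFlux c hf hg j u
    have h2 := fun j => contDiff_greenFlux c hg hf j u
    rw [← integral_unitBall_div hm0 (F := fun j x => greenFlux c f g j x u - greenFlux c g f j x u)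
      fun j => (h1 j).sub (h2 j)]
    congr 1
    ext x
    rw [← sum_pd_greenFlux c hf hg, ← sum_pd_greenFlux c hg hf, ← Finset.sum_sub_distrib]
    exact Finset.sum_congr rfl fun j _ => (pd_sub ((h1 j).differentiable one_ne_zero x)
      ((h2 j).differentiable one_ne_zero x) j).symm
  simp_rw [hL, hR]
  rw [integral_integral_swap (integrable_ball_prod_sphere (w := fun z =>
    greenFluxDiv c f g z.1 z.2 - greenFluxDiv c g f z.1 z.2)
    ((continuous_greenFluxDiv c hf hg).sub (continuous_greenFluxDiv c hg hf)))]
  simp_rw [hdiv]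
  refine integral_integral_swap (integrable_sphere_prod_sphere (w := fun z =>
    ∑ j, z.2 j * (greenFlux c f g j z.2 z.1 - greenFlux c g f j z.2 z.1)) ?_)
  have h1 := continuous_greenFlux c hf hg
  have h2 := continuous_greenFlux c hg hf
  exact continuous_finsetSum _ fun j _ =>
    ((contDiff_coord (n := 0) j).continuous.comp continuous_snd).mul
      (((h1 j).comp continuous_swap).sub ((h2 j).comp continuous_swap))
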